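/- arXiv:2303.00103 — 2 statements merged into one kernel-verified Lean document; each statement's English description precedes it below -/
import Mathlib

section
/- Let α ∈ ℂ and ω := exp(2πi/3). For every real-differentiable function u = (u₁, u₂) : ℂ → ℂ² and every z ∈ ℂ, the chiral TBG operator D(α) satisfies the rotation intertwining relation [D(α)(u ∘ (ω·))](z) = conj(ω) · [D(α)u](ω·z), where u ∘ (ω·) denotes the function z ↦ u(ω·z). -/
/-- `ω = exp(2πi/3)`. -/
noncomputable def ω : ℂ := Complex.exp (2 * Real.pi * Complex.I / 3)

/-- The tunneling potential `U(z) = Σ_{k=0}^{2} ω^k exp((z ω̄^k − z̄ ω^k)/2)`. -/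
noncomputable def U (z : ℂ) : ℂ :=
  ∑ k ∈ Finset.range 3,
    ω ^ k * Complex.exp ((z * (starRingEnd ℂ ω) ^ k - (starRingEnd ℂ z) * ω ^ k) / 2)

/-- `(2 D_{z̄} f)(z) = −i (∂₁ f(z) + i ∂₂ f(z))`. -/
noncomputable def Dzbar (f : ℂ → ℂ) (z : ℂ) : ℂ :=
  -Complex.I * (fderiv ℝ f z 1 + Complex.I * fderiv ℝ f z Complex.I)

/-- The chiral TBG operator `D(α)` acting on `u = (u₁, u₂) : ℂ → ℂ²`. -/
noncomputable def Dop (α : ℂ) (u : ℂ → ℂ × ℂ) (z : ℂ) : ℂ × ℂ :=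
  (Dzbar (fun w => (u w).1) z + α * U z * (u z).2,
   α * U (-z) * (u z).1 + Dzbar (fun w => (u w).2) z)

theorem om_cube : ω ^ 3 = 1 := by
  rw [ω, ← Complex.exp_nat_mul, ← Complex.exp_two_pi_mul_I]
  congr 1
  push_cast
  ring

theorem om_conj : ω * (starRingEnd ℂ ω) = 1 := by
  have h : ‖ω‖ = 1 := by
    have := congrArg norm om_cube
    rw [norm_pow, norm_one] at this
    exact (pow_eq_one_iff_of_nonneg (norm_nonneg _) (by norm_num)).1 this
  rw [Complex.mul_conj, Complex.normSq_eq_norm_sq, h]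
  norm_num

theorem U_rot (z : ℂ) : (starRingEnd ℂ ω) * U (ω * z) = U z := by
  have h3 := om_cube
  have hc := om_conj
  simp only [U, Finset.sum_range_succ, Finset.sum_range_zero, map_mul]
  generalize (starRingEnd ℂ ω) = c at *
  generalize (starRingEnd ℂ z) = y at *
  generalize ω = w at *
  have hcw : c = w ^ 2 := by linear_combination w ^ 2 * hc - c * h3
  have e0 : (w * z * c ^ 0 - c * y * w ^ 0) / 2 = (z * c ^ 2 - y * w ^ 2) / 2 := by
    subst hcw; linear_combination (-z * w / 2) * h3
  have e1 : (w * z * c ^ 1 - c * y * w ^ 1) / 2 = (z * c ^ 0 - y * w ^ 0) / 2 := by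
    linear_combination ((z - y) / 2) * hc
  have e2 : (w * z * c ^ 2 - c * y * w ^ 2) / 2 = (z * c ^ 1 - y * w ^ 1) / 2 := by
    linear_combination ((z * c - y * w) / 2) * hc
  rw [e0, e1, e2]
  generalize Complex.exp ((z * c ^ 2 - y * w ^ 2) / 2) = A
  generalize Complex.exp ((z * c ^ 1 - y * w ^ 1) / 2) = B
  generalize Complex.exp ((z * c ^ 0 - y * w ^ 0) / 2) = C
  linear_combination A * hcw + (C + w * B) * hc

theorem Dzbar_rot (f : ℂ → ℂ) (hf : Differentiable ℝ f) (z : ℂ) :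
    Dzbar (fun w => f (ω * w)) z = (starRingEnd ℂ ω) * Dzbar f (ω * z) := by
  have h1 : HasFDerivAt (fun w : ℂ => ω * w) (ContinuousLinearMap.mul ℝ ℂ ω) z :=
    (ContinuousLinearMap.mul ℝ ℂ ω).hasFDerivAt
  have h2 := (hf (ω * z)).hasFDerivAt.comp z h1
  have h3 : fderiv ℝ (fun w => f (ω * w)) z = _ := h2.fderiv
  have key : ∀ (L : ℂ →L[ℝ] ℂ) (a : ℂ), L a = a.re * L 1 + a.im * L Complex.I := by
    intro L a
    conv_lhs => rw [show a = a.re • (1 : ℂ) + a.im • Complex.I by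
      simp [Complex.re_add_im]]
    rw [map_add, map_smul, map_smul, Complex.real_smul, Complex.real_smul]
  simp only [Dzbar]
  rw [h3]
  simp only [ContinuousLinearMap.comp_apply, ContinuousLinearMap.mul_apply']
  generalize fderiv ℝ f (ω * z) = L
  rw [key L (ω * 1), key L (ω * Complex.I)]
  have hconj : (starRingEnd ℂ ω) = ω.re - ω.im * Complex.I := by
    apply Complex.ext <;> simp
  rw [hconj]
  simp
  linear_combination (ω.im * L Complex.I * Complex.I) * Complex.I_sq

/-- Rotational intertwining: `[D(α)(u ∘ (ω·))](z) = ω̄ [D(α)u](ωz)`. -/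
theorem Dop_rotation (α : ℂ) (u : ℂ → ℂ × ℂ) (hu : Differentiable ℝ u) (z : ℂ) :
    Dop α (fun w => u (ω * w)) z = (starRingEnd ℂ ω) • Dop α u (ω * z) := by
  have a1 := Dzbar_rot (fun w => (u w).1) hu.fst z
  have a2 := Dzbar_rot (fun w => (u w).2) hu.snd z
  have b1 := U_rot z
  have b2 := U_rot (-z)
  rw [mul_neg] at b2
  simp only [Dop, Prod.smul_mk, smul_eq_mul]
  rw [a1, a2, ← b1, ← b2]
  ext <;> ring
end

section
/- Let ω := exp(2πi/3), α ∈ ℂ, k ∈ ℂ, set 𝐤 := √3·ω·k and z_S := (4πiω/9)·(ω − 1). Define F_𝐤(z) := exp(2π·(ζ − conj(ζ))·k/√3) · θ(ζ + k)/θ(ζ) with ζ := 3z/(4πiω). Suppose u = (u₁, u₂) : ℂ → ℂ² is real-differentiable and satisfies (D(α)u)(z) = 0 for all z ∈ ℂ. Define v(z) := F_𝐤(z + z_S)·u(z) (componentwise scalar multiplication). Then for every z ∈ ℂ with θ(3(z + z_S)/(4πiω)) ≠ 0, one has (D(α)v)(z) + 𝐤·v(z) = 0. -/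
/-- The odd Jacobi theta function with modular parameter `ω`. -/
noncomputable def θf (ζ : ℂ) : ℂ :=
  -∑' n : ℤ, Complex.exp ((Real.pi : ℂ) * Complex.I * ((n : ℂ) + 1 / 2) ^ 2 * ω
      + 2 * (Real.pi : ℂ) * Complex.I * ((n : ℂ) + 1 / 2) * (ζ + 1 / 2))

/-- `F_k(ζ) = exp(2π(ζ − ζ̄)k/√3) · θ(ζ + k)/θ(ζ)`. -/
noncomputable def Ff (k ζ : ℂ) : ℂ :=
  Complex.exp (2 * (Real.pi : ℂ) * (ζ - starRingEnd ℂ ζ) * k / (Real.sqrt 3 : ℂ))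
    * θf (ζ + k) / θf ζ

/-- `F_𝐤(z) = F_k(3z/(4πiω))`, the transplant to the moiré lattice,
with `𝐤 = √3 ω k`. -/
noncomputable def FK (k z : ℂ) : ℂ :=
  Ff k (3 * z / (4 * (Real.pi : ℂ) * Complex.I * ω))

/-- The stacking point `z_S = (4πiω/9)(ω − 1)`. -/
noncomputable def zS : ℂ := (4 * (Real.pi : ℂ) * Complex.I * ω / 9) * (ω - 1)

lemma ω_im_pos : 0 < ω.im := by
  have h : ω = Complex.exp (((2 * Real.pi / 3 : ℝ) : ℂ) * Complex.I) := by
    unfold ω; congr 1; push_cast; ring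
  rw [h, Complex.exp_ofReal_mul_I_im]
  apply Real.sin_pos_of_pos_of_lt_pi <;> linarith [Real.pi_pos]

lemma ω_conj : (starRingEnd ℂ) ω = ω⁻¹ := by
  unfold ω
  rw [← Complex.exp_conj, ← Complex.exp_neg]
  congr 1
  simp only [map_div₀, map_mul, map_ofNat, Complex.conj_ofReal, Complex.conj_I]
  ring

lemma ω_ne : ω ≠ 0 := Complex.exp_ne_zero _

lemma θf_eq (ζ : ℂ) : θf ζ = -(Complex.exp ((Real.pi : ℂ) * Complex.I * ω / 4
    + Real.pi * Complex.I * (ζ + 1 / 2)) * jacobiTheta₂ (ζ + 1 / 2 + ω / 2) ω) := by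
  unfold θf jacobiTheta₂
  rw [← tsum_mul_left]
  congr 1
  apply tsum_congr
  intro n
  rw [jacobiTheta₂_term, ← Complex.exp_add]
  congr 1
  ring

lemma θf_diff : Differentiable ℂ θf := by
  have h : θf = fun ζ => -(Complex.exp ((Real.pi : ℂ) * Complex.I * ω / 4
    + Real.pi * Complex.I * (ζ + 1 / 2)) * jacobiTheta₂ (ζ + 1 / 2 + ω / 2) ω) :=
    funext θf_eq
  rw [h]
  intro ζ
  apply DifferentiableAt.neg
  apply DifferentiableAt.mul
  · fun_prop
  · exact DifferentiableAt.comp (f := fun ζ : ℂ => ζ + 1 / 2 + ω / 2)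
      (g := fun x => jacobiTheta₂ x ω) ζ
      (differentiableAt_jacobiTheta₂_fst _ ω_im_pos) (by fun_prop)

lemma Dzbar_mul {f g : ℂ → ℂ} {z : ℂ} (hf : DifferentiableAt ℝ f z)
    (hg : DifferentiableAt ℝ g z) :
    Dzbar (fun w => f w * g w) z = Dzbar f z * g z + f z * Dzbar g z := by
  unfold Dzbar
  rw [fderiv_fun_mul hf hg]
  simp
  ring

lemma Dzbar_holo {f : ℂ → ℂ} {z : ℂ} (hf : DifferentiableAt ℂ f z) : Dzbar f z = 0 := by
  unfold Dzbar
  rw [hf.fderiv_restrictScalars ℝ]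
  have h : fderiv ℂ f z Complex.I = Complex.I * fderiv ℂ f z 1 := by
    rw [← smul_eq_mul, ← map_smul]; simp
  simp only [ContinuousLinearMap.coe_restrictScalars', h]
  linear_combination (-Complex.I * fderiv ℂ f z 1) * Complex.I_mul_I

lemma exp_conj_hasFDerivAt (a z : ℂ) :
    HasFDerivAt (𝕜 := ℝ) (fun w : ℂ => Complex.exp (a * (starRingEnd ℂ) w))
      (Complex.exp (a * (starRingEnd ℂ) z) • (a • (Complex.conjCLE : ℂ →L[ℝ] ℂ))) z := by
  have h : HasFDerivAt (𝕜 := ℝ) (fun w : ℂ => a * (starRingEnd ℂ) w)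
      (a • (Complex.conjCLE : ℂ →L[ℝ] ℂ)) z :=
    (Complex.conjCLE.hasFDerivAt (x := z)).const_mul a
  exact h.cexp

lemma Dzbar_exp_conj (a z : ℂ) : Dzbar (fun w : ℂ => Complex.exp (a * (starRingEnd ℂ) w)) z
    = -2 * Complex.I * a * Complex.exp (a * (starRingEnd ℂ) z) := by
  unfold Dzbar
  rw [(exp_conj_hasFDerivAt a z).fderiv]
  simp
  linear_combination (-Complex.I * Complex.exp (a * (starRingEnd ℂ) z) * a) * Complex.I_mul_I

lemma FK_key (k z : ℂ) (hz : θf (3 * (z + zS) / (4 * (Real.pi : ℂ) * Complex.I * ω)) ≠ 0) :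
    DifferentiableAt ℝ (fun w => FK k (w + zS)) z ∧
    Dzbar (fun w => FK k (w + zS)) z = -((Real.sqrt 3 : ℂ) * ω * k) * FK k (z + zS) := by
  have hpi : (Real.pi : ℂ) ≠ 0 := by exact_mod_cast Real.pi_ne_zero
  have h3 : (Real.sqrt 3 : ℂ) ≠ 0 := by
    exact_mod_cast (Real.sqrt_pos.mpr (by norm_num : (0:ℝ) < 3)).ne'
  have h33 : (Real.sqrt 3 : ℂ) ^ 2 = 3 := by
    exact_mod_cast Real.sq_sqrt (by norm_num : (0:ℝ) ≤ 3)
  have hω := ω_ne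
  set a : ℂ := -(3 * Complex.I * ω * k) / (2 * (Real.sqrt 3 : ℂ)) with ha
  set G : ℂ → ℂ := fun w =>
    Complex.exp (2 * (Real.pi : ℂ) * (3 * (w + zS) / (4 * (Real.pi : ℂ) * Complex.I * ω)) * k
      / (Real.sqrt 3 : ℂ) + a * (starRingEnd ℂ) zS)
    * θf (3 * (w + zS) / (4 * (Real.pi : ℂ) * Complex.I * ω) + k)
    / θf (3 * (w + zS) / (4 * (Real.pi : ℂ) * Complex.I * ω)) with hG
  have hF : (fun w => FK k (w + zS)) = fun w => G w * Complex.exp (a * (starRingEnd ℂ) w) := by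
    funext w
    simp only [hG, FK, Ff]
    rw [div_mul_eq_mul_div, mul_right_comm (Complex.exp (_ + _)), ← Complex.exp_add]
    congr 3
    simp only [map_div₀, map_mul, map_add, Complex.conj_ofReal, Complex.conj_I, ω_conj, map_ofNat]
    rw [ha]
    field_simp
    ring_nf
    simp only [Complex.I_sq]
    ring
  have hGd : DifferentiableAt ℂ G z := by
    have h1 : DifferentiableAt ℂ
        (fun w => θf (3 * (w + zS) / (4 * (Real.pi : ℂ) * Complex.I * ω) + k)) z :=
      DifferentiableAt.comp (g := θf) z (θf_diff _) (by fun_prop)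
    have h2 : DifferentiableAt ℂ
        (fun w => θf (3 * (w + zS) / (4 * (Real.pi : ℂ) * Complex.I * ω))) z :=
      DifferentiableAt.comp (g := θf) z (θf_diff _) (by fun_prop)
    exact (DifferentiableAt.mul (by fun_prop) h1).div h2 hz
  have hGr := hGd.restrictScalars ℝ
  have hE := (exp_conj_hasFDerivAt a z).differentiableAt
  have hFz := congrFun hF z
  rw [hFz, hF]
  refine ⟨hGr.mul hE, ?_⟩
  rw [Dzbar_mul hGr hE, Dzbar_holo hGd, Dzbar_exp_conj]
  have : -2 * Complex.I * a = -((Real.sqrt 3 : ℂ) * ω * k) := by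
    rw [ha]
    field_simp
    rw [h33, Complex.I_sq]
    ring
  rw [this]
  ring

/-- The theta-function construction of flat-band Bloch eigenfunctions: if
`D(α)u = 0` everywhere, then `v(z) = F_𝐤(z + z_S) u(z)` solves
`(D(α) + 𝐤)v = 0` (with `𝐤 = √3 ω k`) away from the pole lattice. -/
theorem flat_band_eigenfunction (α k : ℂ) (u : ℂ → ℂ × ℂ)
    (hu : Differentiable ℝ u) (hsol : ∀ z : ℂ, Dop α u z = 0) (z : ℂ)
    (hz : θf (3 * (z + zS) / (4 * (Real.pi : ℂ) * Complex.I * ω)) ≠ 0) :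
    Dop α (fun w => FK k (w + zS) • u w) z
      + ((Real.sqrt 3 : ℂ) * ω * k) • (FK k (z + zS) • u z) = 0 := by
  obtain ⟨hFd, hFD⟩ := FK_key k z hz
  have h := hsol z
  have hu1 : DifferentiableAt ℝ (fun w => (u w).1) z := (hu z).fst
  have hu2 : DifferentiableAt ℝ (fun w => (u w).2) z := (hu z).snd
  simp only [Dop, Prod.ext_iff, Prod.fst_zero, Prod.snd_zero] at h
  obtain ⟨h1, h2⟩ := h
  simp only [Dop, Prod.smul_fst, Prod.smul_snd, smul_eq_mul]
  rw [Dzbar_mul hFd hu1, Dzbar_mul hFd hu2, hFD]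
  ext
  · simp only [Prod.fst_add, Prod.smul_fst, smul_eq_mul, Prod.fst_zero]
    linear_combination FK k (z + zS) * h1
  · simp only [Prod.snd_add, Prod.smul_snd, smul_eq_mul, Prod.snd_zero]
    linear_combination FK k (z + zS) * h2
end
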